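/- The free group F_n acting on the positive cone P_≺ of the Magnus ordering on F_∞ = ker(π_1) preserves it: for every w ∈ F_n and every a ∈ P_≺, the conjugate w a w^{-1} (computed in F_n * G) lies in P_≺, provided G is left-orderable and the variables X_{g,i} are ordered by X_{g,i} > X_{g',j} iff g > g' in the left-order on G, or g = g' and i > j. -/

import Mathlib

open Classical in
/-- The ring of formal power series over `ℤ` in non-commuting variables indexed by `X`:
coefficient functions on the free monoid of monomials, with convolution product. -/
def NCSeries (X : Type*) : Type _ := FreeMonoid X → ℤ

namespace NCSeries

variable {X : Type*}

instance : AddCommGroup (NCSeries X) := inferInstanceAs (AddCommGroup (FreeMonoid X → ℤ))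

open Classical in
noncomputable instance : One (NCSeries X) := ⟨fun w => if w = 1 then 1 else 0⟩

instance : Mul (NCSeries X) :=
  ⟨fun f g w => ∑ i ∈ Finset.range ((FreeMonoid.toList w).length + 1),
    f (FreeMonoid.ofList ((FreeMonoid.toList w).take i)) *
      g (FreeMonoid.ofList ((FreeMonoid.toList w).drop i))⟩

theorem mul_apply (f g : NCSeries X) (w : FreeMonoid X) :
    (f * g) w = ∑ i ∈ Finset.range ((FreeMonoid.toList w).length + 1),
      f (FreeMonoid.ofList ((FreeMonoid.toList w).take i)) *
        g (FreeMonoid.ofList ((FreeMonoid.toList w).drop i)) := rfl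

open Classical in
theorem one_apply (w : FreeMonoid X) : (1 : NCSeries X) w = if w = 1 then 1 else 0 := rfl

theorem add_apply (f g : NCSeries X) (w : FreeMonoid X) : (f + g) w = f w + g w := rfl

theorem zero_apply (w : FreeMonoid X) : (0 : NCSeries X) w = 0 := rfl

theorem ofList_eq_one_iff (l : List X) : FreeMonoid.ofList l = 1 ↔ l = [] := by
  constructor
  · intro h; simpa using congrArg FreeMonoid.toList h
  · rintro rfl; rfl

noncomputable instance : Ring (NCSeries X) where
  __ := (inferInstance : AddCommGroup (NCSeries X))
  one_mul f := by
    funext w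
    rw [mul_apply, Finset.sum_eq_single 0]
    · simp [one_apply, ofList_eq_one_iff]
    · intro b hb hb0
      have : ¬ ((FreeMonoid.toList w).take b = []) := by
        rw [List.take_eq_nil_iff]
        rw [Finset.mem_range] at hb
        rintro (rfl | hnil)
        · exact hb0 rfl
        · simp [hnil] at hb; omega
      rw [one_apply, if_neg, zero_mul]
      rw [ofList_eq_one_iff]; exact this
    · intro h0; exact absurd (Finset.mem_range.2 (Nat.succ_pos _)) h0
  mul_one f := by
    funext w
    rw [mul_apply, Finset.sum_eq_single ((FreeMonoid.toList w).length)]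
    · simp [one_apply, ofList_eq_one_iff]
    · intro b hb hb'
      rw [Finset.mem_range] at hb
      rw [one_apply, if_neg, mul_zero]
      rw [ofList_eq_one_iff, List.drop_eq_nil_iff]
      omega
    · intro h0; exact absurd (Finset.mem_range.2 (Nat.lt_succ_self _)) h0
  mul_assoc f g h := by
    funext w
    set l := FreeMonoid.toList w with hl
    have key : ∀ j ∈ Finset.range (l.length + 1),
        (f * g) (FreeMonoid.ofList (l.take j)) * h (FreeMonoid.ofList (l.drop j)) =
        ∑ i ∈ Finset.range (j + 1),
          f (FreeMonoid.ofList (l.take i)) *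
            g (FreeMonoid.ofList ((l.drop i).take (j - i))) *
            h (FreeMonoid.ofList (l.drop j)) := by
      intro j hj
      rw [Finset.mem_range] at hj
      rw [mul_apply, Finset.sum_mul]
      simp only [FreeMonoid.toList_ofList]
      rw [List.length_take, min_eq_left (by omega)]
      refine Finset.sum_congr rfl fun i hi => ?_
      rw [Finset.mem_range] at hi
      rw [List.take_take, min_eq_left (by omega), List.drop_take]
    have key2 : ∀ i ∈ Finset.range (l.length + 1),
        f (FreeMonoid.ofList (l.take i)) * (g * h) (FreeMonoid.ofList (l.drop i)) =
        ∑ k ∈ Finset.range ((l.length - i) + 1),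
          f (FreeMonoid.ofList (l.take i)) *
            (g (FreeMonoid.ofList ((l.drop i).take k)) *
              h (FreeMonoid.ofList (l.drop (i + k)))) := by
      intro i hi
      rw [Finset.mem_range] at hi
      rw [mul_apply, Finset.mul_sum]
      simp only [FreeMonoid.toList_ofList]
      rw [List.length_drop]
      refine Finset.sum_congr rfl fun k hk => ?_
      rw [List.drop_drop]
    show (f * g * h) w = (f * (g * h)) w
    rw [mul_apply, Finset.sum_congr rfl key, Finset.sum_sigma']
    rw [mul_apply, Finset.sum_congr rfl key2, Finset.sum_sigma']
    refine Finset.sum_nbij' (fun p => ⟨p.2, p.1 - p.2⟩) (fun p => ⟨p.1 + p.2, p.1⟩)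
      ?_ ?_ ?_ ?_ ?_
    · rintro ⟨j, i⟩ hp
      simp only [Finset.mem_sigma, Finset.mem_range] at hp ⊢
      omega
    · rintro ⟨i, k⟩ hp
      simp only [Finset.mem_sigma, Finset.mem_range] at hp ⊢
      omega
    · rintro ⟨j, i⟩ hp
      simp only [Finset.mem_sigma, Finset.mem_range] at hp
      simp only [Sigma.mk.inj_iff, heq_eq_eq]
      exact ⟨by omega, trivial⟩
    · rintro ⟨i, k⟩ hp
      simp only [Finset.mem_sigma, Finset.mem_range] at hp
      simp only [Sigma.mk.inj_iff, heq_eq_eq]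
      refine ⟨by trivial, by omega⟩
    · rintro ⟨j, i⟩ hp
      simp only [Finset.mem_sigma, Finset.mem_range] at hp
      have hij : i + (j - i) = j := by omega
      rw [hij, mul_assoc]
  left_distrib f g h := by
    funext w
    simp only [mul_apply, add_apply, mul_add, Finset.sum_add_distrib]
  right_distrib f g h := by
    funext w
    simp only [mul_apply, add_apply, add_mul, Finset.sum_add_distrib]
  zero_mul f := by funext w; simp [mul_apply, zero_apply]
  mul_zero f := by funext w; simp [mul_apply, zero_apply]

open Classical in
/-- The variable `X_x` as a power series. -/
noncomputable def Xvar (x : X) : NCSeries X :=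
  fun w => if w = FreeMonoid.of x then 1 else 0

end NCSeries

open Monoid

/-- A strict total order on a group `G` invariant under left multiplication. -/
def IsLeftOrder (G : Type*) [Group G] (r : G → G → Prop) : Prop :=
  IsStrictTotalOrder G r ∧ ∀ g x y : G, r x y → r (g * x) (g * y)

def piTwo {G : Type*} [Group G] {n : ℕ} (ts : Fin n → G) : FreeGroup (Fin n) →* G :=
  FreeGroup.lift ts

def piOne {G : Type*} [Group G] {n : ℕ} (ts : Fin n → G) : Coprod (FreeGroup (Fin n)) G →* G :=
  Coprod.lift (piTwo ts) (MonoidHom.id G)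

/-- The element `x_{g,i} = g sᵢ (ts i)⁻¹ g⁻¹` of the free product `Fₙ * G`. -/
def xgen {G : Type*} [Group G] {n : ℕ} (ts : Fin n → G) (g : G) (i : Fin n) :
    Coprod (FreeGroup (Fin n)) G :=
  Coprod.inr g * Coprod.inl (FreeGroup.of i) * Coprod.inr (ts i)⁻¹ * Coprod.inr g⁻¹

/-- The order on the variables `X_{g,i}`: `X_{g,i} > X_{g',j}` iff `g > g'` in the
left-order on `G`, or `g = g'` and `i > j`. -/
def varLt {G : Type*} {n : ℕ} (lt : G → G → Prop) (p q : G × Fin n) : Prop :=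
  lt p.1 q.1 ∨ (p.1 = q.1 ∧ p.2 < q.2)

/-- The shortlex order on monomials induced by an order `r` on the variables. -/
def shortlex {X : Type*} (r : X → X → Prop) (u v : FreeMonoid X) : Prop :=
  (FreeMonoid.toList u).length < (FreeMonoid.toList v).length ∨
    ((FreeMonoid.toList u).length = (FreeMonoid.toList v).length ∧
      List.Lex r (FreeMonoid.toList u) (FreeMonoid.toList v))

/-- The Magnus ordering on the free group on variables `X`, relative to a variable order
`r` and the Magnus expansion `f`. -/
def magnusLt {X : Type*} (r : X → X → Prop) (f : FreeGroup X →* (NCSeries X)ˣ)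
    (a b : FreeGroup X) : Prop :=
  ∃ m : FreeMonoid X,
    ((f a : (NCSeries X)ˣ) : NCSeries X) m < ((f b : (NCSeries X)ˣ) : NCSeries X) m ∧
    ∀ m' : FreeMonoid X, shortlex r m' m →
      ((f a : (NCSeries X)ˣ) : NCSeries X) m' = ((f b : (NCSeries X)ˣ) : NCSeries X) m'

theorem aux_mul_left {X : Type*} (u h : NCSeries X) (L : ℕ)
    (hh : ∀ m : FreeMonoid X, (FreeMonoid.toList m).length < L → h m = 0)
    (m : FreeMonoid X) (hm : (FreeMonoid.toList m).length ≤ L) :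
    (u * h) m = u 1 * h m := by
  rw [NCSeries.mul_apply, Finset.sum_eq_single 0]
  · simp
  · intro b hb hb0
    rw [Finset.mem_range] at hb
    rw [hh, mul_zero]
    rw [FreeMonoid.toList_ofList, List.length_drop]
    omega
  · intro h0; exact absurd (Finset.mem_range.2 (Nat.succ_pos _)) h0

theorem aux_mul_right {X : Type*} (h v : NCSeries X) (L : ℕ)
    (hh : ∀ m : FreeMonoid X, (FreeMonoid.toList m).length < L → h m = 0)
    (m : FreeMonoid X) (hm : (FreeMonoid.toList m).length ≤ L) :
    (h * v) m = h m * v 1 := by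
  rw [NCSeries.mul_apply, Finset.sum_eq_single ((FreeMonoid.toList m).length)]
  · simp
  · intro b hb hb0
    rw [Finset.mem_range] at hb
    rw [hh, zero_mul]
    rw [FreeMonoid.toList_ofList, List.length_take]
    omega
  · intro h0; exact absurd (Finset.mem_range.2 (Nat.lt_succ_self _)) h0

theorem aux_conj {X : Type*} (u : (NCSeries X)ˣ) (F : NCSeries X) (L : ℕ)
    (hh : ∀ m : FreeMonoid X, (FreeMonoid.toList m).length < L → (1 : NCSeries X) m = F m)
    (m : FreeMonoid X) (hm : (FreeMonoid.toList m).length ≤ L) :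
    ((u : NCSeries X) * F * ((u⁻¹ : (NCSeries X)ˣ) : NCSeries X)) m = F m := by
  obtain ⟨h, rfl⟩ : ∃ h, F = 1 + h := ⟨F - 1, by abel⟩
  have hz : ∀ m : FreeMonoid X, (FreeMonoid.toList m).length < L → h m = 0 := by
    intro m hm
    have := hh m hm
    rw [NCSeries.add_apply] at this
    linarith
  have hz2 : ∀ m : FreeMonoid X, (FreeMonoid.toList m).length < L →
      ((u : NCSeries X) * h) m = 0 := by
    intro m hm
    rw [aux_mul_left _ _ L hz m hm.le, hz m hm, mul_zero]
  have h1 : (u : NCSeries X) 1 * ((u⁻¹ : (NCSeries X)ˣ) : NCSeries X) 1 = 1 := by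
    have h2 : ((u : NCSeries X) * ((u⁻¹ : (NCSeries X)ˣ) : NCSeries X)) 1 = 1 := by
      rw [Units.mul_inv, NCSeries.one_apply, if_pos rfl]
    rw [aux_mul_left _ _ 0 (fun m hm => absurd hm (Nat.not_lt_zero _)) 1 (by simp)] at h2
    exact h2
  rw [mul_add, add_mul, mul_one, Units.mul_inv, NCSeries.add_apply, NCSeries.add_apply,
    aux_mul_right _ _ L hz2 m hm, aux_mul_left _ _ L hz m hm]
  linear_combination h m * h1

/-- Relabelling of variables. -/
noncomputable def auxT {X : Type*} (σ : X ≃ X) : NCSeries X →* NCSeries X where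
  toFun h := fun w => h (FreeMonoid.map σ.symm w)
  map_one' := by
    funext w
    rw [NCSeries.one_apply, NCSeries.one_apply]
    congr 1
    apply propext
    constructor
    · intro h
      have := congrArg (FreeMonoid.map σ) h
      simpa [FreeMonoid.map_map] using this
    · rintro rfl; simp
  map_mul' a b := by
    funext w
    refine (NCSeries.mul_apply _ _ _).trans (Eq.trans ?_ (NCSeries.mul_apply _ _ _).symm)
    simp [FreeMonoid.toList_map, ← List.map_take, ← List.map_drop, FreeMonoid.ofList_map]


theorem auxT_apply {X : Type*} (σ : X ≃ X) (h : NCSeries X) (w : FreeMonoid X) :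
    auxT σ h w = h (FreeMonoid.map σ.symm w) := rfl

theorem aux_map_symm {X : Type*} (σ : X ≃ X) (w : FreeMonoid X) :
    FreeMonoid.map σ.symm (FreeMonoid.map σ w) = w := by
  simp [FreeMonoid.map_map]

theorem aux_map_symm2 {X : Type*} (σ : X ≃ X) (w : FreeMonoid X) :
    FreeMonoid.map σ (FreeMonoid.map σ.symm w) = w := by
  simp [FreeMonoid.map_map]

theorem auxT_var {X : Type*} (σ : X ≃ X) (p : X) :
    auxT σ (1 + NCSeries.Xvar p) = 1 + NCSeries.Xvar (σ p) := by
  have h1 : auxT σ (1 + NCSeries.Xvar p) = auxT σ 1 + auxT σ (NCSeries.Xvar p) := rfl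
  rw [h1, map_one]
  congr 1
  funext w
  rw [auxT_apply]
  unfold NCSeries.Xvar
  congr 1
  apply propext
  constructor
  · intro h
    rw [← aux_map_symm2 σ w, h, FreeMonoid.map_of]
  · rintro rfl
    rw [FreeMonoid.map_of, Equiv.symm_apply_apply]

theorem aux_f_map {X : Type*} (σ : X ≃ X) (f : FreeGroup X →* (NCSeries X)ˣ)
    (hf : ∀ p, ((f (FreeGroup.of p) : (NCSeries X)ˣ) : NCSeries X) = 1 + NCSeries.Xvar p)
    (c : FreeGroup X) :
    ((f (FreeGroup.map σ c) : (NCSeries X)ˣ) : NCSeries X) = auxT σ (f c) := by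
  have : f.comp (FreeGroup.map σ) = (Units.map (auxT σ)).comp f := by
    apply FreeGroup.ext_hom
    intro p
    apply Units.ext
    simp only [MonoidHom.comp_apply, FreeGroup.map.of, Units.coe_map, MonoidHom.coe_coe]
    rw [hf, hf, auxT_var]
  exact congrArg Units.val (DFunLike.congr_fun this c)

theorem aux_shortlex {X : Type*} (r : X → X → Prop) (σ : X ≃ X)
    (hσ : ∀ x y, r (σ x) (σ y) → r x y) (m m' : FreeMonoid X)
    (h : shortlex r m' (FreeMonoid.map σ m)) :
    shortlex r (FreeMonoid.map σ.symm m') m := by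
  have hσ' : ∀ x y, r x y → r (σ.symm x) (σ.symm y) := fun x y hxy =>
    hσ _ _ (by simpa using hxy)
  rcases h with h | ⟨h1, h2⟩
  · left
    simpa [FreeMonoid.toList_map] using h
  · right
    refine ⟨by simpa [FreeMonoid.toList_map] using h1, ?_⟩
    have h3 : ∀ l₁ l₂ : List X, List.Lex r l₁ l₂ →
        List.Lex r (l₁.map σ.symm) (l₂.map σ.symm) := by
      intro l₁ l₂ h
      induction h with
      | nil => exact List.Lex.nil
      | cons _ ih => exact List.Lex.cons ih
      | rel h => exact List.Lex.rel (hσ' _ _ h)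
    have := h3 _ _ h2
    rw [← FreeMonoid.toList_map, ← FreeMonoid.toList_map, aux_map_symm] at this
    exact this

theorem aux_magnus_conj {X : Type*} (r : X → X → Prop) (f : FreeGroup X →* (NCSeries X)ˣ)
    (k c : FreeGroup X) (h : magnusLt r f 1 c) : magnusLt r f 1 (k * c * k⁻¹) := by
  obtain ⟨m, hm, hm'⟩ := h
  rw [map_one, Units.val_one] at hm
  simp only [map_one, Units.val_one] at hm'
  have key := aux_conj (f k) (f c) (FreeMonoid.toList m).length
    (fun m' h => hm' m' (Or.inl h))
  refine ⟨m, ?_, ?_⟩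
  · simp only [map_one, map_mul, map_inv, Units.val_one, Units.val_mul]
    rw [key m le_rfl]; exact hm
  · intro m' h
    simp only [map_one, map_mul, map_inv, Units.val_one, Units.val_mul]
    rw [key m' (by rcases h with h | h; exacts [h.le, h.1.le])]
    exact hm' m' h

theorem aux_magnus_map {X : Type*} (r : X → X → Prop) (f : FreeGroup X →* (NCSeries X)ˣ)
    (hf : ∀ p, ((f (FreeGroup.of p) : (NCSeries X)ˣ) : NCSeries X) = 1 + NCSeries.Xvar p)
    (σ : X ≃ X) (hσ : ∀ x y, r (σ x) (σ y) → r x y)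
    (c : FreeGroup X) (h : magnusLt r f 1 c) : magnusLt r f 1 (FreeGroup.map σ c) := by
  obtain ⟨m, hm, hm'⟩ := h
  rw [map_one, Units.val_one] at hm
  simp only [map_one, Units.val_one] at hm'
  refine ⟨FreeMonoid.map σ m, ?_, ?_⟩
  · rw [aux_f_map σ f hf, map_one, Units.val_one, ← map_one (auxT σ), auxT_apply, auxT_apply,
      aux_map_symm]
    exact hm
  · intro m' h
    rw [aux_f_map σ f hf, map_one, Units.val_one, ← map_one (auxT σ), auxT_apply, auxT_apply]
    exact hm' _ (aux_shortlex r σ hσ _ _ h)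

/-- If `G` is left-orderable, then the conjugation action of `Fₙ` on
`F_∞ = ker (π₁ : Fₙ * G → G)` (free on the `x_{g,i}`) preserves the positive cone of the
Magnus ordering whose variables are ordered via the left order on `G`. -/
theorem conj_action_preserves_magnus_positive_cone
    {G : Type*} [Group G] {n : ℕ} (ts : Fin n → G)
    (hgen : Subgroup.closure (Set.range ts) = ⊤)
    (lt : G → G → Prop) (hlt : IsLeftOrder G lt)
    (f : FreeGroup (G × Fin n) →* (NCSeries (G × Fin n))ˣ)
    (hf : ∀ p : G × Fin n,
      ((f (FreeGroup.of p) : (NCSeries (G × Fin n))ˣ) : NCSeries (G × Fin n)) =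
        1 + NCSeries.Xvar p)
    (e : FreeGroup (G × Fin n) ≃* (piOne ts).ker)
    (he : ∀ (g : G) (i : Fin n),
      ((e (FreeGroup.of (g, i)) : (piOne ts).ker) : Coprod (FreeGroup (Fin n)) G) =
        xgen ts g i) :
    ∀ (w : FreeGroup (Fin n)) (a : (piOne ts).ker),
      magnusLt (varLt lt) f 1 (e.symm a) →
      ∃ b : (piOne ts).ker,
        ((b : (piOne ts).ker) : Coprod (FreeGroup (Fin n)) G) =
          Coprod.inl w * (a : Coprod (FreeGroup (Fin n)) G) * (Coprod.inl w :
            Coprod (FreeGroup (Fin n)) G)⁻¹ ∧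
        magnusLt (varLt lt) f 1 (e.symm b) := by
  intro w a ha
  obtain ⟨hst, hleft⟩ := hlt
  set g : G := piTwo ts w with hg
  let σ : G × Fin n ≃ G × Fin n := (Equiv.mulLeft g).prodCongr (Equiv.refl _)
  have hσap : ∀ (h : G) (i : Fin n), σ (h, i) = (g * h, i) := fun _ _ => rfl
  have hσ : ∀ x y, varLt lt (σ x) (σ y) → varLt lt x y := by
    rintro ⟨x, i⟩ ⟨y, j⟩ h
    rcases h with h | ⟨h1, h2⟩
    · left
      have := hleft g⁻¹ _ _ h
      simpa [hσap] using this
    · right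
      exact ⟨mul_left_cancel h1, h2⟩
  have hmap : ∀ c : FreeGroup (G × Fin n),
      ((e (FreeGroup.map σ c) : (piOne ts).ker) : Coprod (FreeGroup (Fin n)) G) =
        Coprod.inr g * ((e c : (piOne ts).ker) : Coprod (FreeGroup (Fin n)) G) * (Coprod.inr g)⁻¹ := by
    have : ((piOne ts).ker.subtype.comp e.toMonoidHom).comp (FreeGroup.map σ) =
        (MulAut.conj (Coprod.inr g : Coprod (FreeGroup (Fin n)) G)).toMonoidHom.comp
          ((piOne ts).ker.subtype.comp e.toMonoidHom) := by
      apply FreeGroup.ext_hom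
      rintro ⟨h, i⟩
      simp only [MonoidHom.comp_apply, FreeGroup.map.of, hσap, MulEquiv.coe_toMonoidHom,
        Subgroup.coe_subtype, he, MulAut.conj_apply]
      simp only [xgen, map_mul, mul_inv_rev, map_inv, mul_assoc]
    intro c
    exact DFunLike.congr_fun this c
  have hk : (Coprod.inl w * (Coprod.inr g)⁻¹ : Coprod (FreeGroup (Fin n)) G) ∈
      (piOne ts).ker := by
    rw [MonoidHom.mem_ker]
    simp [piOne, hg]
  let k : (piOne ts).ker := ⟨_, hk⟩
  refine ⟨k * e (FreeGroup.map σ (e.symm a)) * k⁻¹, ?_, ?_⟩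
  · rw [Subgroup.coe_mul, Subgroup.coe_mul, hmap, Subgroup.coe_inv, MulEquiv.apply_symm_apply]
    simp only [k]
    group
  · rw [map_mul, map_mul, map_inv, MulEquiv.symm_apply_apply]
    exact aux_magnus_conj _ _ _ _ (aux_magnus_map _ _ hf σ hσ _ ha)
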